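/- Define g : ℝ^p → ℝ by g(x) = max( f_φ(x) − ‖x‖₁/(1+p), 0 ), where ‖x‖₁ = Σ_{i=1}^p |x_i|. Then ∫_{ℝ^p} g(x)² dx > 0 if and only if φ is satisfiable (i.e., there exists a Boolean assignment a ∈ {0,1}^p satisfying φ). -/

import Mathlib

open MeasureTheory

noncomputable def f0 (ε x : ℝ) : ℝ :=
  ε⁻¹ * (max 0 (x + ε) - 2 * max 0 x + max 0 (x - ε))

noncomputable def f1 (ε x : ℝ) : ℝ := f0 ε (x - 1)

/-- A literal over `p` Boolean variables: a variable index and a polarity. -/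
structure Lit (p : ℕ) where
  idx : Fin p
  pos : Bool

/-- Value of a literal on a real input: `f1` for a positive literal, `f0` for a negated one. -/
noncomputable def litVal (ε : ℝ) {p : ℕ} (L : Lit p) (x : Fin p → ℝ) : ℝ :=
  if L.pos then f1 ε (x L.idx) else f0 ε (x L.idx)

/-- Clause function `g_j(x) = Σ_{k=1}^{3} f0(ℓ₁(x) + ℓ₂(x) + ℓ₃(x) − k)`. -/
noncomputable def clauseVal (ε : ℝ) {p : ℕ} (C : Fin 3 → Lit p) (x : Fin p → ℝ) : ℝ :=
  ∑ k ∈ Finset.Icc (1 : ℕ) 3, f0 ε ((∑ t, litVal ε (C t) x) - (k : ℝ))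

/-- Formula function `f_φ(x) = f0(Σ_{j=1}^{c} g_j(x) − c)`. -/
noncomputable def cnfVal (ε : ℝ) {p c : ℕ} (φ : Fin c → Fin 3 → Lit p) (x : Fin p → ℝ) : ℝ :=
  f0 ε ((∑ j, clauseVal ε (φ j) x) - (c : ℝ))

/-- A Boolean assignment satisfies `φ` if every clause has a true literal. -/
def Satisfies {p c : ℕ} (a : Fin p → Bool) (φ : Fin c → Fin 3 → Lit p) : Prop :=
  ∀ j, ∃ t, a (φ j t).idx = (φ j t).pos

/-- Real embedding of a Boolean assignment. -/
noncomputable def embed {p : ℕ} (a : Fin p → Bool) : Fin p → ℝ :=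
  fun i => if a i then 1 else 0

theorem f0_eq {ε : ℝ} (hε : 0 < ε) (x : ℝ) : f0 ε x = max 0 (1 - |x| / ε) := by
  have h : max 0 (x + ε) - 2 * max 0 x + max 0 (x - ε) = max 0 (ε - |x|) := by
    grind
  have h' : 1 - |x| / ε = ε⁻¹ * (ε - |x|) := by field_simp
  rw [f0, h, h', mul_max_of_nonneg _ _ (inv_nonneg.2 hε.le), mul_zero]

theorem f0_zero {ε : ℝ} (hε : 0 < ε) : f0 ε 0 = 1 := by
  simp [f0_eq hε]

theorem f0_nonneg {ε : ℝ} (hε : 0 < ε) (x : ℝ) : 0 ≤ f0 ε x := by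
  simp [f0_eq hε]

theorem f0_le_one {ε : ℝ} (hε : 0 < ε) (x : ℝ) : f0 ε x ≤ 1 := by
  rw [f0_eq hε]
  exact max_le zero_le_one (sub_le_self _ (by positivity))

theorem f0_eq_zero {ε x : ℝ} (hε : 0 < ε) (hx : ε ≤ |x|) : f0 ε x = 0 := by
  rw [f0_eq hε, max_eq_left]
  rw [sub_nonpos, le_div_iff₀ hε]
  linarith

theorem abs_lt_of_f0_pos {ε x : ℝ} (hε : 0 < ε) (hx : 0 < f0 ε x) : |x| < ε := by
  by_contra! h
  exact hx.ne' (f0_eq_zero hε h)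

@[fun_prop]
theorem continuous_f0 (ε : ℝ) : Continuous (f0 ε) := by
  unfold f0
  fun_prop

theorem continuous_litVal (ε : ℝ) {p : ℕ} (L : Lit p) : Continuous (litVal ε L) := by
  unfold litVal f1
  split_ifs <;> fun_prop

theorem continuous_clauseVal (ε : ℝ) {p : ℕ} (C : Fin 3 → Lit p) :
    Continuous (clauseVal ε C) := by
  have := fun t => continuous_litVal ε (C t)
  unfold clauseVal
  fun_prop

theorem continuous_cnfVal (ε : ℝ) {p c : ℕ} (φ : Fin c → Fin 3 → Lit p) :
    Continuous (cnfVal ε φ) := by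
  have := fun j => continuous_clauseVal ε (φ j)
  unfold cnfVal
  fun_prop

theorem clauseVal_eq (ε : ℝ) {p : ℕ} (C : Fin 3 → Lit p) (x : Fin p → ℝ) :
    clauseVal ε C x = f0 ε ((∑ t, litVal ε (C t) x) - 1) +
      f0 ε ((∑ t, litVal ε (C t) x) - 2) + f0 ε ((∑ t, litVal ε (C t) x) - 3) := by
  simp [clauseVal, Finset.sum_Icc_succ_top]

theorem clauseVal_le_one {ε : ℝ} (hε : 0 < ε) (hε' : ε < 1 / 2) {p : ℕ}
    (C : Fin 3 → Lit p) (x : Fin p → ℝ) : clauseVal ε C x ≤ 1 := by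
  rw [clauseVal_eq]
  generalize ∑ t, litVal ε (C t) x = s
  have h1 := f0_le_one hε (s - 1)
  have h2 := f0_le_one hε (s - 2)
  have h3 := f0_le_one hε (s - 3)
  have z1 := @f0_eq_zero ε (s - 1) hε
  have z2 := @f0_eq_zero ε (s - 2) hε
  have z3 := @f0_eq_zero ε (s - 3) hε
  grind

theorem exists_litVal_pos {ε : ℝ} (hε : 0 < ε) (hε' : ε < 1 / 2) {p : ℕ}
    {C : Fin 3 → Lit p} {x : Fin p → ℝ} (h : 0 < clauseVal ε C x) :
    ∃ t, 0 < litVal ε (C t) x := by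
  by_contra! hn
  have hs : ∑ t, litVal ε (C t) x ≤ 0 := Finset.sum_nonpos fun t _ => hn t
  rw [clauseVal_eq] at h
  generalize ∑ t, litVal ε (C t) x = s at h hs
  have z1 := @f0_eq_zero ε (s - 1) hε
  have z2 := @f0_eq_zero ε (s - 2) hε
  have z3 := @f0_eq_zero ε (s - 3) hε
  grind

theorem decide_eq_of_litVal_pos {ε : ℝ} (hε : 0 < ε) (hε' : ε < 1 / 2) {p : ℕ}
    {L : Lit p} {x : Fin p → ℝ} (h : 0 < litVal ε L x) :
    decide (1 / 2 < x L.idx) = L.pos := by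
  unfold litVal f1 at h
  cases hL : L.pos
  · have := abs_lt.1 (abs_lt_of_f0_pos hε (by simpa [hL] using h))
    rw [decide_eq_false_iff_not]
    linarith
  · have := abs_lt.1 (abs_lt_of_f0_pos hε (by simpa [hL] using h))
    rw [decide_eq_true_iff]
    linarith

theorem satisfies_of_cnfVal_pos {ε : ℝ} (hε : 0 < ε) (hε' : ε < 1 / 2) {p c : ℕ}
    {φ : Fin c → Fin 3 → Lit p} {x : Fin p → ℝ} (h : 0 < cnfVal ε φ x) :
    Satisfies (fun i => decide (1 / 2 < x i)) φ := by
  intro j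
  have hsum := abs_lt.1 (abs_lt_of_f0_pos hε h)
  have hj : 0 < clauseVal ε (φ j) x := by
    have hle : 1 - clauseVal ε (φ j) x ≤ ∑ i, (1 - clauseVal ε (φ i) x) :=
      Finset.single_le_sum (f := fun i => 1 - clauseVal ε (φ i) x)
        (fun i _ => sub_nonneg.2 (clauseVal_le_one hε hε' _ _)) (Finset.mem_univ j)
    simp only [Finset.sum_sub_distrib, Finset.sum_const, Finset.card_univ, Fintype.card_fin,
      nsmul_eq_mul, mul_one] at hle
    linarith
  obtain ⟨t, ht⟩ := exists_litVal_pos hε hε' hj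
  exact ⟨t, decide_eq_of_litVal_pos hε hε' ht⟩

theorem litVal_embed {ε : ℝ} (hε : 0 < ε) (hε' : ε < 1 / 2) {p : ℕ} (L : Lit p)
    (a : Fin p → Bool) : litVal ε L (embed a) = if a L.idx = L.pos then 1 else 0 := by
  have h1 : f0 ε 1 = 0 := f0_eq_zero hε (by rw [abs_one]; linarith)
  have h2 : f0 ε (-1) = 0 := f0_eq_zero hε (by rw [abs_neg, abs_one]; linarith)
  cases ha : a L.idx <;> cases hL : L.pos <;>
    simp [litVal, f1, embed, ha, hL, h1, h2, f0_zero hε]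

theorem clauseVal_embed {ε : ℝ} (hε : 0 < ε) (hε' : ε < 1 / 2) {p : ℕ}
    {C : Fin 3 → Lit p} {a : Fin p → Bool} (h : ∃ t, a (C t).idx = (C t).pos) :
    clauseVal ε C (embed a) = 1 := by
  have z1 : f0 ε 1 = 0 := f0_eq_zero hε (by rw [abs_one]; linarith)
  have z2 : f0 ε (-1) = 0 := f0_eq_zero hε (by rw [abs_neg, abs_one]; linarith)
  have z3 : f0 ε 2 = 0 := f0_eq_zero hε (by rw [abs_two]; linarith)
  have z4 : f0 ε (-2) = 0 := f0_eq_zero hε (by rw [abs_neg, abs_two]; linarith)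
  rw [clauseVal_eq]
  simp only [litVal_embed hε hε', Fin.sum_univ_three]
  rw [Fin.exists_fin_succ, Fin.exists_fin_two] at h
  simp only [Fin.succ_zero_eq_one, Fin.succ_one_eq_two] at h
  split_ifs <;> first
    | (norm_num [z1, z2, z3, z4, f0_zero hε]; done)
    | simp_all

theorem cnfVal_embed {ε : ℝ} (hε : 0 < ε) (hε' : ε < 1 / 2) {p c : ℕ}
    {φ : Fin c → Fin 3 → Lit p} {a : Fin p → Bool} (h : Satisfies a φ) :
    cnfVal ε φ (embed a) = 1 := by
  simp [cnfVal, clauseVal_embed hε hε' (h _), f0_zero hε]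

theorem sum_abs_embed_le {p : ℕ} (a : Fin p → Bool) : ∑ i, |embed a i| ≤ p := by
  calc ∑ i, |embed a i| ≤ ∑ _i : Fin p, (1 : ℝ) :=
        Finset.sum_le_sum fun i _ => by unfold embed; split_ifs <;> simp
    _ = p := by simp

theorem stmt11 (ε : ℝ) (hε : 0 < ε) (hε' : ε < 1 / 2)
    (p c : ℕ) (φ : Fin c → Fin 3 → Lit p) :
    0 < ∫⁻ x : Fin p → ℝ,
          ENNReal.ofReal
            ((max (cnfVal ε φ x - (∑ i, |x i|) / (1 + (p : ℝ))) 0) ^ 2) ↔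
      ∃ a : Fin p → Bool, Satisfies a φ := by
  constructor
  · intro h
    obtain ⟨x, hx⟩ : ∃ x : Fin p → ℝ, 0 < cnfVal ε φ x := by
      by_contra! hn
      have hz : ∀ x : Fin p → ℝ,
          max (cnfVal ε φ x - (∑ i, |x i|) / (1 + (p : ℝ))) 0 = 0 := fun x =>
        max_eq_right (sub_nonpos.2 ((hn x).trans (by positivity)))
      simp [hz] at h
    exact ⟨_, satisfies_of_cnfVal_pos hε hε' hx⟩
  · rintro ⟨a, ha⟩
    have hcont : Continuous fun x : Fin p → ℝ => ENNReal.ofReal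
        ((max (cnfVal ε φ x - (∑ i, |x i|) / (1 + (p : ℝ))) 0) ^ 2) := by
      have := continuous_cnfVal ε φ
      exact ENNReal.continuous_ofReal.comp (by fun_prop)
    rw [lintegral_pos_iff_support hcont.measurable]
    refine hcont.isOpen_support.measure_pos volume ⟨embed a, ?_⟩
    have hlt : (∑ i, |embed a i|) / (1 + (p : ℝ)) < 1 := by
      rw [div_lt_one (by positivity)]
      linarith [sum_abs_embed_le a]
    rw [Function.mem_support, cnfVal_embed hε hε' ha]
    refine (ENNReal.ofReal_pos.2 (pow_pos (lt_max_of_lt_left ?_) 2)).ne'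
    linarith
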